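/- Let I and J be finite interpretations, Δ' ⊆ Δ^I and Δ'' ⊆ Δ^J, and suppose Names(Δ', I) ≠ ∅ and Names(Δ'', J) ≠ ∅. Let Z be the maximal ALC bisimulation between I and J. Then Names(Δ', I) = Names(Δ'', J) if and only if Z is total over Δ^I × Δ^J and the restriction Z ∩ (NamedInd(Δ', I) × NamedInd(Δ'', J)) is total over NamedInd(Δ', I) × NamedInd(Δ'', J). -/

import Mathlib

universe u v

namespace DL

/-- ALCι concepts, with atomic concept names and role names both drawn from
the countably infinite (and disjoint, being distinct sorts) sets `ℕ`. -/
inductive Concept : Type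
  | atom : ℕ → Concept
  | neg : Concept → Concept
  | conj : Concept → Concept → Concept
  | ex : ℕ → Concept → Concept
  | iotaL : Concept → Concept
  | iotaG : Concept → Concept → Concept
  deriving DecidableEq

/-- An interpretation with (nonempty) domain `D`. -/
structure Interp (D : Type u) where
  atomI : ℕ → Set D
  roleI : ℕ → Set (D × D)

/-- The extension `C^I` of a concept `C` in the interpretation `I`. -/
def Interp.sem {D : Type u} (I : Interp D) : Concept → Set D
  | .atom A => I.atomI A
  | .neg C => (I.sem C)ᶜ
  | .conj C D' => I.sem C ∩ I.sem D'
  | .ex r C => {d | ∃ e, (d, e) ∈ I.roleI r ∧ e ∈ I.sem C}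
  | .iotaL C => {d | I.sem C = {d}}
  | .iotaG C D' => {_d | ∃ e, I.sem C = {e} ∧ e ∈ I.sem D'}

/-- Concepts not using the global definite description constructor `ιC.D`,
i.e. ALCι_L concepts. -/
def Concept.noG : Concept → Prop
  | .atom _ => True
  | .neg C => C.noG
  | .conj C D => C.noG ∧ D.noG
  | .ex _ C => C.noG
  | .iotaL C => C.noG
  | .iotaG _ _ => False

/-- Concepts not using the local definite description constructor `{ιC}`,
i.e. ALCι_G concepts. -/
def Concept.noL : Concept → Prop
  | .atom _ => True
  | .neg C => C.noL
  | .conj C D => C.noL ∧ D.noL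
  | .ex _ C => C.noL
  | .iotaL _ => False
  | .iotaG C D => C.noL ∧ D.noL

/-- ALC concepts: neither local nor global definite descriptions. -/
def Concept.isALC (C : Concept) : Prop := C.noG ∧ C.noL

/-- Condition (Atom) for a relation `Z ⊆ Δ^I × Δ^J`. -/
def AtomCond {D : Type u} {E : Type v} (I : Interp D) (J : Interp E) (Z : Set (D × E)) : Prop :=
  ∀ p ∈ Z, ∀ A : ℕ, p.1 ∈ I.atomI A ↔ p.2 ∈ J.atomI A

/-- Condition (Forth). -/
def ForthCond {D : Type u} {E : Type v} (I : Interp D) (J : Interp E) (Z : Set (D × E)) : Prop :=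
  ∀ p ∈ Z, ∀ r : ℕ, ∀ d' : D, (p.1, d') ∈ I.roleI r →
    ∃ e' : E, (p.2, e') ∈ J.roleI r ∧ (d', e') ∈ Z

/-- Condition (Back). -/
def BackCond {D : Type u} {E : Type v} (I : Interp D) (J : Interp E) (Z : Set (D × E)) : Prop :=
  ∀ p ∈ Z, ∀ r : ℕ, ∀ e' : E, (p.2, e') ∈ J.roleI r →
    ∃ d' : D, (p.1, d') ∈ I.roleI r ∧ (d', e') ∈ Z

/-- `Names(Δ', I)`: the set of ALC concepts whose extension in `I` is a
singleton `{d}` with `d ∈ Δ'`. -/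
def Names {D : Type u} (Δ' : Set D) (I : Interp D) : Set Concept :=
  {C | C.isALC ∧ ∃ d ∈ Δ', I.sem C = {d}}

/-- The domain of a relation. -/
def Dom {D : Type u} {E : Type v} (Z : Set (D × E)) : Set D := {d | ∃ e, (d, e) ∈ Z}

/-- The range of a relation. -/
def Rng {D : Type u} {E : Type v} (Z : Set (D × E)) : Set E := {e | ∃ d, (d, e) ∈ Z}

/-- ALCι_L bisimulations between `I` and `J`. -/
def IsBisimL {D : Type u} {E : Type v} (I : Interp D) (J : Interp E) (Z : Set (D × E)) : Prop :=
  Z = ∅ ∨ (AtomCond I J Z ∧ ForthCond I J Z ∧ BackCond I J Z ∧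
    Names (Dom Z) I = Names (Rng Z) J)

/-- ALCι_G bisimulations between `I` and `J`. -/
def IsBisimG {D : Type u} {E : Type v} (I : Interp D) (J : Interp E) (Z : Set (D × E)) : Prop :=
  Z = ∅ ∨ (AtomCond I J Z ∧ ForthCond I J Z ∧ BackCond I J Z ∧
    Names (Set.univ : Set D) I = Names (Set.univ : Set E) J)

/-- ALC bisimulations between `I` and `J`. -/
def IsBisimALC {D : Type u} {E : Type v} (I : Interp D) (J : Interp E) (Z : Set (D × E)) : Prop :=
  AtomCond I J Z ∧ ForthCond I J Z ∧ BackCond I J Z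

/-- The maximal ALC bisimulation between `I` and `J`: the union of all ALC
bisimulations between them. -/
def maxBisimALC {D : Type u} {E : Type v} (I : Interp D) (J : Interp E) : Set (D × E) :=
  ⋃₀ {Z | IsBisimALC I J Z}

/-- `NamedInd(Δ', I)`: the named individuals of `Δ'`. -/
def NamedInd {D : Type u} (Δ' : Set D) (I : Interp D) : Set D :=
  {d ∈ Δ' | ∃ C ∈ Names Δ' I, d ∈ I.sem C}

/-- A relation `Z` is total over `X × Y`. -/
def TotalOver {D : Type u} {E : Type v} (Z : Set (D × E)) (X : Set D) (Y : Set E) : Prop :=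
  (∀ x ∈ X, ∃ y ∈ Y, (x, y) ∈ Z) ∧ (∀ y ∈ Y, ∃ x ∈ X, (x, y) ∈ Z)

/-- Two points are ALC-equivalent if they satisfy the same ALC concepts. -/
def ALCEquiv {D : Type u} {E : Type v} (I : Interp D) (J : Interp E) (d : D) (e : E) : Prop :=
  ∀ C : Concept, C.isALC → (d ∈ I.sem C ↔ e ∈ J.sem C)

theorem ALCEquiv.symm {D : Type u} {E : Type v} {I : Interp D} {J : Interp E} {d : D} {e : E}
    (h : ALCEquiv I J d e) : ALCEquiv J I e d :=
  fun C hC => (h C hC).symm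

theorem IsBisimALC.alcEquiv {D : Type u} {E : Type v} {I : Interp D} {J : Interp E}
    {Z : Set (D × E)} (hZ : IsBisimALC I J Z) {d : D} {e : E} (h : (d, e) ∈ Z) :
    ALCEquiv I J d e := by
  intro C
  induction C generalizing d e with
  | atom A => exact fun _ => hZ.1 _ h A
  | neg C ih => exact fun hC => not_congr (ih h hC)
  | conj C C' ih ih' =>
    exact fun hC => and_congr (ih h ⟨hC.1.1, hC.2.1⟩) (ih' h ⟨hC.1.2, hC.2.2⟩)
  | ex r C ih =>
    intro hC
    constructor
    · rintro ⟨d', hd', hdC⟩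
      obtain ⟨e', he', hZ'⟩ := hZ.2.1 _ h r d' hd'
      exact ⟨e', he', (ih hZ' hC).1 hdC⟩
    · rintro ⟨e', he', heC⟩
      obtain ⟨d', hd', hZ'⟩ := hZ.2.2 _ h r e' he'
      exact ⟨d', hd', (ih hZ' hC).2 heC⟩
  | iotaL C _ => exact fun hC => hC.2.elim
  | iotaG C C' _ _ => exact fun hC => hC.1.elim

/-- A point that is not equivalent to any member of a finite set is separated from that set by a
single ALC concept. -/
theorem exists_separating_concept {D : Type u} {E : Type v} (I : Interp D) (J : Interp E)
    (d : D) {S : Set E} (hS : S.Finite) (h : ∀ e ∈ S, ¬ ALCEquiv I J d e) :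
    ∃ X : Concept, X.isALC ∧ d ∈ I.sem X ∧ ∀ e ∈ S, e ∉ J.sem X := by
  induction S, hS using Set.Finite.induction_on with
  | empty =>
    exact ⟨.neg (.conj (.atom 0) (.neg (.atom 0))), ⟨⟨trivial, trivial⟩, trivial, trivial⟩,
      fun hd => hd.2 hd.1, fun e he => he.elim⟩
  | @insert e S _ _ ih =>
    obtain ⟨X, hX, hdX, hSX⟩ := ih fun e' he' => h e' (Or.inr he')
    obtain ⟨Y, hY, hdY, heY⟩ : ∃ Y : Concept, Y.isALC ∧ d ∈ I.sem Y ∧ e ∉ J.sem Y := by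
      have hne := h e (Or.inl rfl)
      simp only [ALCEquiv, not_forall] at hne
      obtain ⟨Y, hY, hne⟩ := hne
      by_cases hd : d ∈ I.sem Y
      · exact ⟨Y, hY, hd, fun he => hne ⟨fun _ => he, fun _ => hd⟩⟩
      · refine ⟨.neg Y, hY, hd, fun he => hne ⟨fun h' => (hd h').elim, fun h' => (he h').elim⟩⟩
    refine ⟨.conj X Y, ⟨⟨hX.1, hY.1⟩, hX.2, hY.2⟩, ⟨hdX, hdY⟩, ?_⟩
    rintro e' (rfl | he') ⟨h1, h2⟩
    · exact heY h2
    · exact hSX e' he' h1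

theorem ALCEquiv.forth {D : Type u} {E : Type v} [Finite E] {I : Interp D} {J : Interp E}
    {d d' : D} {e : E} (h : ALCEquiv I J d e) {r : ℕ} (hd : (d, d') ∈ I.roleI r) :
    ∃ e', (e, e') ∈ J.roleI r ∧ ALCEquiv I J d' e' := by
  by_contra! hno
  obtain ⟨X, hX, hdX, hSX⟩ :=
    exists_separating_concept I J d' (Set.toFinite {e' | (e, e') ∈ J.roleI r}) hno
  obtain ⟨e', he', heX⟩ := (h (.ex r X) hX).1 ⟨d', hd, hdX⟩
  exact hSX e' he' heX

/-- Between finite interpretations, maximal bisimilarity coincides with ALC-equivalence. -/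
theorem mem_maxBisimALC_iff {D : Type u} {E : Type v} [Finite D] [Finite E]
    {I : Interp D} {J : Interp E} {d : D} {e : E} :
    (d, e) ∈ maxBisimALC I J ↔ ALCEquiv I J d e := by
  constructor
  · rintro ⟨Z, hZ, h⟩
    exact hZ.alcEquiv h
  · intro h
    refine ⟨{p | ALCEquiv I J p.1 p.2}, ⟨?_, ?_, ?_⟩, h⟩
    · exact fun p hp A => hp (.atom A) ⟨trivial, trivial⟩
    · exact fun p hp r d' hd' => hp.forth hd'
    · intro p hp r e' he'
      obtain ⟨d', hd', h'⟩ := hp.symm.forth he'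
      exact ⟨d', hd', h'.symm⟩

theorem exists_alcEquiv_of_names_eq {D : Type u} {E : Type v} [Finite E]
    {I : Interp D} {J : Interp E} {Δ' : Set D} {Δ'' : Set E}
    (hne : (Names Δ' I).Nonempty) (h : Names Δ' I = Names Δ'' J) (d : D) :
    ∃ e, ALCEquiv I J d e := by
  by_contra! hno
  obtain ⟨X, hX, hdX, hEX⟩ :=
    exists_separating_concept I J d (Set.toFinite Set.univ) fun e _ => hno e
  obtain ⟨C, hC⟩ := hne
  obtain ⟨hCalc, d₀, -, hd₀⟩ := id hC
  obtain ⟨-, e₀, he₀Δ, he₀⟩ : C ∈ Names Δ'' J := h ▸ hC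
  by_cases hdd : d ∈ I.sem C
  · have hmem : Concept.conj C (.neg X) ∈ Names Δ'' J := by
      refine ⟨⟨⟨hCalc.1, hX.1⟩, hCalc.2, hX.2⟩, e₀, he₀Δ, ?_⟩
      rw [← he₀]
      exact Set.inter_eq_left.2 fun e _ => hEX e trivial
    rw [← h] at hmem
    obtain ⟨-, d₁, -, hd₁⟩ := hmem
    have hmem₁ : d₁ ∈ I.sem C ∩ (I.sem X)ᶜ := hd₁.ge rfl
    rw [hd₀] at hdd hmem₁
    obtain rfl : d = d₀ := hdd
    obtain rfl : d₁ = d := hmem₁.1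
    exact hmem₁.2 hdX
  · have hmem : Concept.neg (.conj (.neg C) (.neg X)) ∈ Names Δ'' J := by
      refine ⟨⟨⟨hCalc.1, hX.1⟩, hCalc.2, hX.2⟩, e₀, he₀Δ, ?_⟩
      rw [← he₀]
      ext e
      have := hEX e trivial
      simp [Interp.sem, this]
    rw [← h] at hmem
    obtain ⟨-, d₁, -, hd₁⟩ := hmem
    have hsub : ∀ x, x ∈ I.sem C ∨ x ∈ I.sem X → x = d₁ := by
      intro x hx
      have : x ∈ I.sem (.neg (.conj (.neg C) (.neg X))) := fun hn => hx.elim hn.1 hn.2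
      rwa [hd₁] at this
    have hd₀C : d₀ ∈ I.sem C := hd₀.symm ▸ Set.mem_singleton d₀
    exact hdd ((hsub d (Or.inr hdX)).trans (hsub d₀ (Or.inl hd₀C)).symm ▸ hd₀C)

theorem exists_namedInd_alcEquiv {D : Type u} {E : Type v} [Finite E]
    {I : Interp D} {J : Interp E} {Δ' : Set D} {Δ'' : Set E}
    (h : Names Δ' I = Names Δ'' J) {d : D} (hd : d ∈ NamedInd Δ' I) :
    ∃ e ∈ NamedInd Δ'' J, ALCEquiv I J d e := by
  obtain ⟨-, C, hC, hdC⟩ := hd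
  obtain ⟨e, he⟩ := exists_alcEquiv_of_names_eq ⟨C, hC⟩ h d
  have heC := (he C hC.1).1 hdC
  rw [h] at hC
  obtain ⟨-, e₀, he₀Δ, he₀⟩ := id hC
  have hee : e = e₀ := by rwa [he₀] at heC
  exact ⟨e, ⟨hee ▸ he₀Δ, C, hC, heC⟩, he⟩

theorem names_subset_of_alcEquiv {D : Type u} {E : Type v}
    {I : Interp D} {J : Interp E} {Δ' : Set D} {Δ'' : Set E}
    (hall : ∀ e, ∃ d, ALCEquiv I J d e)
    (hnamed : ∀ d ∈ NamedInd Δ' I, ∃ e ∈ NamedInd Δ'' J, ALCEquiv I J d e) :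
    Names Δ' I ⊆ Names Δ'' J := by
  rintro C ⟨hC, d, hdΔ, hd⟩
  have hdC : d ∈ I.sem C := hd.symm ▸ Set.mem_singleton d
  obtain ⟨e, ⟨heΔ, C', ⟨hC', e₁, -, he₁⟩, heC'⟩, hde⟩ :=
    hnamed d ⟨hdΔ, C, ⟨hC, d, hdΔ, hd⟩, hdC⟩
  refine ⟨hC, e, heΔ, Set.eq_singleton_iff_unique_mem.2 ⟨(hde C hC).1 hdC, fun e' he' => ?_⟩⟩
  obtain ⟨d', hd'⟩ := hall e'
  have hd'C := (hd' C hC).2 he'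
  rw [hd] at hd'C
  obtain rfl : d' = d := hd'C
  have he'C' := (hd' C' hC').1 ((hde C' hC').2 heC')
  rw [he₁] at heC' he'C'
  exact he'C'.trans heC'.symm

/-- for finite interpretations `I`, `J`, subsets `Δ' ⊆ Δ^I`,
`Δ'' ⊆ Δ^J` with `Names(Δ',I) ≠ ∅ ≠ Names(Δ'',J)`, and `Z` the maximal ALC
bisimulation between `I` and `J`: `Names(Δ',I) = Names(Δ'',J)` iff `Z` is
total over `Δ^I × Δ^J` and `Z ∩ (NamedInd(Δ',I) × NamedInd(Δ'',J))` is total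
over `NamedInd(Δ',I) × NamedInd(Δ'',J)`. -/
theorem stmt8 {D : Type u} {E : Type v} [Nonempty D] [Nonempty E]
    [Finite D] [Finite E]
    (I : Interp D) (J : Interp E) (Δ' : Set D) (Δ'' : Set E)
    (h1 : Names Δ' I ≠ ∅) (h2 : Names Δ'' J ≠ ∅) :
    Names Δ' I = Names Δ'' J ↔
      (TotalOver (maxBisimALC I J) Set.univ Set.univ ∧
        TotalOver (maxBisimALC I J ∩ (NamedInd Δ' I) ×ˢ (NamedInd Δ'' J))
          (NamedInd Δ' I) (NamedInd Δ'' J)) := by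
  constructor
  · intro h
    refine ⟨⟨fun d _ => ?_, fun e _ => ?_⟩, fun d hd => ?_, fun e he => ?_⟩
    · obtain ⟨e, he⟩ := exists_alcEquiv_of_names_eq (Set.nonempty_iff_ne_empty.2 h1) h d
      exact ⟨e, trivial, mem_maxBisimALC_iff.2 he⟩
    · obtain ⟨d, hd⟩ := exists_alcEquiv_of_names_eq (Set.nonempty_iff_ne_empty.2 h2) h.symm e
      exact ⟨d, trivial, mem_maxBisimALC_iff.2 hd.symm⟩
    · obtain ⟨e, he, hde⟩ := exists_namedInd_alcEquiv h hd
      exact ⟨e, he, mem_maxBisimALC_iff.2 hde, hd, he⟩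
    · obtain ⟨d, hd, hde⟩ := exists_namedInd_alcEquiv h.symm he
      exact ⟨d, hd, mem_maxBisimALC_iff.2 hde.symm, hd, he⟩
  · rintro ⟨⟨hD, hE⟩, hND, hNE⟩
    apply Set.Subset.antisymm
    · refine names_subset_of_alcEquiv (fun e => ?_) fun d hd => ?_
      · obtain ⟨d, -, hd⟩ := hE e trivial
        exact ⟨d, mem_maxBisimALC_iff.1 hd⟩
      · obtain ⟨e, he, hde⟩ := hND d hd
        exact ⟨e, he, mem_maxBisimALC_iff.1 hde.1⟩
    · refine names_subset_of_alcEquiv (fun d => ?_) fun e he => ?_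
      · obtain ⟨e, -, he⟩ := hD d trivial
        exact ⟨e, (mem_maxBisimALC_iff.1 he).symm⟩
      · obtain ⟨d, hd, hde⟩ := hNE e he
        exact ⟨d, hd, (mem_maxBisimALC_iff.1 hde.1).symm⟩

end DL
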